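/- (Lemma 5.1, subsolution) Let μ ∈ (0,2), let V_μ = {(r cos θ, r sin θ) : 0 < r < ∞, 0 < θ < μπ} ⊂ ℝ², let v_μ(r,θ) = −log( μ r sin(θ/μ) ), and let A > 0. Then the function u̲_μ(z) = v_μ(z) − log( 1 + A |z|^{1/μ} ) satisfies Δu̲_μ ≥ e^{2u̲_μ} everywhere in V_μ. -/

import Mathlib

/-- The Laplacian of a function on `ℂ ≅ ℝ²`: sum of the second directional
derivatives in the two coordinate directions `1` and `I`. -/
noncomputable def lap (u : ℂ → ℝ) (z : ℂ) : ℝ :=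
  fderiv ℝ (fun w => fderiv ℝ u w 1) z 1 +
  fderiv ℝ (fun w => fderiv ℝ u w Complex.I) z Complex.I

/-- The polar angle of a nonzero complex number, normalized to lie in `(0, 2π]`. -/
noncomputable def polarAngle (z : ℂ) : ℝ :=
  if 0 < Complex.arg z then Complex.arg z else Complex.arg z + 2 * Real.pi

/-- The open infinite cone `V_μ = {(r cos θ, r sin θ) : 0 < r, 0 < θ < μπ}` in `ℂ ≅ ℝ²`. -/
def cone (μ : ℝ) : Set ℂ :=
  {z | ∃ r θ : ℝ, 0 < r ∧ 0 < θ ∧ θ < μ * Real.pi ∧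
    z = (r : ℂ) * Complex.exp ((θ : ℂ) * Complex.I)}

open Filter Topology

theorem Filter.EventuallyEq.lap_eq {f g : ℂ → ℝ} {z : ℂ} (h : f =ᶠ[𝓝 z] g) :
    lap f z = lap g z := by
  have hv (v : ℂ) : (fun y => fderiv ℝ f y v) =ᶠ[𝓝 z] fun y => fderiv ℝ g y v :=
    h.fderiv.fun_comp (· v)
  rw [lap, lap, (hv 1).fderiv_eq, (hv Complex.I).fderiv_eq]

/-- The Laplacian of `a (re L) + b (im L)` for holomorphic `L`. -/
theorem lap_re_add_im_comp {L L' : ℂ → ℂ} {L'' z : ℂ} {a a' b b' : ℝ → ℝ} {a'' b'' : ℝ}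
    (hL : ∀ᶠ y in 𝓝 z, HasDerivAt L (L' y) y) (hL' : HasDerivAt L' L'' z)
    (ha : ∀ᶠ y in 𝓝 z, HasDerivAt a (a' (L y).re) (L y).re)
    (hb : ∀ᶠ y in 𝓝 z, HasDerivAt b (b' (L y).im) (L y).im)
    (ha' : HasDerivAt a' a'' (L z).re) (hb' : HasDerivAt b' b'' (L z).im) :
    lap (fun y => a (L y).re + b (L y).im) z = (a'' + b'') * Complex.normSq (L' z) := by
  have hre {f : ℂ → ℂ} {f' y : ℂ} (h : HasDerivAt f f' y) :=
    Complex.reCLM.hasFDerivAt.comp y (h.hasFDerivAt.restrictScalars ℝ)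
  have him {f : ℂ → ℂ} {f' y : ℂ} (h : HasDerivAt f f' y) :=
    Complex.imCLM.hasFDerivAt.comp y (h.hasFDerivAt.restrictScalars ℝ)
  have first (v : ℂ) : (fun y => fderiv ℝ (fun y => a (L y).re + b (L y).im) y v) =ᶠ[𝓝 z]
      fun y => a' (L y).re * (v * L' y).re + b' (L y).im * (v * L' y).im := by
    filter_upwards [hL, ha, hb] with y h1 h2 h3
    have h := (h2.comp_hasFDerivAt y (hre h1)).add (h3.comp_hasFDerivAt y (him h1))
    have h' : fderiv ℝ (fun y => a (L y).re + b (L y).im) y = _ := h.fderiv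
    rw [h']
    simp
  have second (v : ℂ) : fderiv ℝ (fun y => fderiv ℝ (fun y => a (L y).re + b (L y).im) y v) z v =
      a'' * (v * L' z).re ^ 2 + a' (L z).re * (v * (v * L'')).re
        + (b'' * (v * L' z).im ^ 2 + b' (L z).im * (v * (v * L'')).im) := by
    rw [(first v).fderiv_eq]
    have h1 := hL.self_of_nhds
    have h2 := hL'.const_mul v
    have h := ((ha'.comp_hasFDerivAt z (hre h1)).mul (hre h2)).add
      ((hb'.comp_hasFDerivAt z (him h1)).mul (him h2))
    have h' : fderiv ℝ (fun y => a' (L y).re * (v * L' y).re + b' (L y).im * (v * L' y).im) z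
      = _ := h.fderiv
    rw [h']
    simp
    ring
  rw [lap, second, second, Complex.normSq_apply]
  simp
  ring

/-- The branch of the logarithm on `ℂ ∖ [0, ∞)` with imaginary part in `(0, 2π)`. -/
noncomputable def cutLog (z : ℂ) : ℂ := Complex.log (-z) + Real.pi * Complex.I

theorem hasDerivAt_cutLog {z : ℂ} (hz : -z ∈ Complex.slitPlane) :
    HasDerivAt cutLog z⁻¹ z := by
  have h := ((Complex.hasDerivAt_log hz).comp z (hasDerivAt_neg z)).add_const
    (Real.pi * Complex.I)
  exact h.congr_deriv (by simp [inv_neg])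

theorem cutLog_re (z : ℂ) : (cutLog z).re = Real.log ‖z‖ := by
  simp [cutLog, Complex.log_re]

theorem cutLog_im {z : ℂ} (hz : -z ∈ Complex.slitPlane) : (cutLog z).im = polarAngle z := by
  have him : (cutLog z).im = (-z).arg + Real.pi := by simp [cutLog, Complex.log_im]
  rw [him, polarAngle]
  rcases lt_trichotomy z.im 0 with h | h | h
  · rw [Complex.arg_neg_eq_arg_add_pi_of_im_neg h, if_neg (Complex.arg_neg_iff.2 h).not_gt]
    ring
  · have hre : z.re < 0 := by
      simpa [Complex.mem_slitPlane_iff, h] using hz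
    have h1 : z.arg = Real.pi := Complex.arg_eq_pi_iff.2 ⟨hre, h⟩
    have h2 : (-z).arg = 0 := Complex.arg_eq_zero_iff.2 ⟨by simpa using hre.le, by simp [h]⟩
    rw [h1, h2, if_pos Real.pi_pos, zero_add]
  · have h0 : 0 < z.arg := by
      refine lt_of_le_of_ne (Complex.arg_nonneg_iff.2 h.le) fun h' => ?_
      exact h.ne' (Complex.arg_eq_zero_iff.1 h'.symm).2
    rw [Complex.arg_neg_eq_arg_sub_pi_of_im_pos h, if_pos h0]
    ring

theorem neg_mem_slitPlane_and_polarAngle_of_mem_cone {μ : ℝ} (hμ2 : μ < 2) {z : ℂ}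
    (hz : z ∈ cone μ) :
    -z ∈ Complex.slitPlane ∧ 0 < polarAngle z ∧ polarAngle z < μ * Real.pi := by
  obtain ⟨r, θ, hr, h0, hθ, rfl⟩ := hz
  have hθ2 : θ < 2 * Real.pi := hθ.trans (by nlinarith [Real.pi_pos])
  have hneg : -((r : ℂ) * Complex.exp (θ * Complex.I)) =
      r * Complex.exp ((θ - Real.pi : ℝ) * Complex.I) := by
    push_cast
    rw [sub_mul, Complex.exp_sub, Complex.exp_pi_mul_I]
    ring
  have hmem : θ - Real.pi ∈ Set.Ioc (-Real.pi) Real.pi := ⟨by linarith, by linarith⟩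
  have harg : (-((r : ℂ) * Complex.exp (θ * Complex.I))).arg = θ - Real.pi := by
    rw [hneg, Complex.exp_mul_I, Complex.arg_mul_cos_add_sin_mul_I hr hmem]
  have hs : -((r : ℂ) * Complex.exp (θ * Complex.I)) ∈ Complex.slitPlane := by
    rw [Complex.mem_slitPlane_iff_arg, harg]
    exact ⟨by linarith, by simp [hr.ne']⟩
  have hp : polarAngle ((r : ℂ) * Complex.exp (θ * Complex.I)) = θ := by
    rw [← cutLog_im hs]
    simp [cutLog, Complex.log_im, harg]
  exact ⟨hs, hp.symm ▸ h0, hp.symm ▸ hθ⟩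

theorem sin_div_pos_of_mem_Ioo {μ θ : ℝ} (hμ : 0 < μ) (h0 : 0 < θ) (hθ : θ < μ * Real.pi) :
    0 < Real.sin (θ / μ) :=
  Real.sin_pos_of_pos_of_lt_pi (by positivity) (by rwa [div_lt_iff₀' hμ])

theorem hasDerivAt_neg_log_sin_div {μ x : ℝ} (hx : Real.sin (x / μ) ≠ 0) :
    HasDerivAt (fun x => -Real.log (Real.sin (x / μ)))
      (-(Real.cos (x / μ) * (1 / μ) / Real.sin (x / μ))) x :=
  (((hasDerivAt_id x).div_const μ).sin.log hx).neg

theorem hasDerivAt_neg_cot_div {μ x : ℝ} (hx : Real.sin (x / μ) ≠ 0) :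
    HasDerivAt (fun x => -(Real.cos (x / μ) * (1 / μ) / Real.sin (x / μ)))
      ((1 / μ) ^ 2 / Real.sin (x / μ) ^ 2) x := by
  have h := (hasDerivAt_id x).div_const μ
  refine ((h.cos.mul_const (1 / μ)).div h.sin hx).neg.congr_deriv ?_
  rw [id, ← neg_div]
  congr 1
  linear_combination ((1 / μ) ^ 2) * Real.sin_sq_add_cos_sq (x / μ)

theorem hasDerivAt_neg_sub_log_one_add_exp {A s : ℝ} (hA : 0 < A) (c x : ℝ) :
    HasDerivAt (fun x => c - x - Real.log (1 + A * Real.exp (s * x)))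
      (-1 - A * (Real.exp (s * x) * s) / (1 + A * Real.exp (s * x))) x := by
  have h := (((hasDerivAt_id x).const_mul s).exp.const_mul A).const_add 1
  have hpos : 1 + A * Real.exp (s * x) ≠ 0 := by positivity
  exact (((hasDerivAt_id x).const_sub c).sub (h.log hpos)).congr_deriv (by simp)

theorem hasDerivAt_neg_one_sub_logistic {A s : ℝ} (hA : 0 < A) (x : ℝ) :
    HasDerivAt (fun x => -1 - A * (Real.exp (s * x) * s) / (1 + A * Real.exp (s * x)))
      (-(s ^ 2 * (A * Real.exp (s * x))) / (1 + A * Real.exp (s * x)) ^ 2) x := by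
  have he := ((hasDerivAt_id x).const_mul s).exp
  have hpos : 1 + A * Real.exp (s * x) ≠ 0 := by positivity
  refine ((((he.mul_const s).const_mul A).div ((he.const_mul A).const_add 1) hpos).const_sub
    (-1)).congr_deriv ?_
  rw [id, ← neg_div]
  congr 1
  ring

theorem liouville_ineq {s r σ q : ℝ} (hr : 0 < r) (hσ : 0 < σ) (hσ1 : σ ≤ 1) (hq : 0 < q) :
    (s / (r * σ * (1 + q))) ^ 2 ≤
      (-(s ^ 2 * q) / (1 + q) ^ 2 + s ^ 2 / σ ^ 2) * (1 / r ^ 2) := by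
  have h : (-(s ^ 2 * q) / (1 + q) ^ 2 + s ^ 2 / σ ^ 2) * (1 / r ^ 2) -
      (s / (r * σ * (1 + q))) ^ 2 =
      s ^ 2 * (q * (2 + q - σ ^ 2)) / (r * σ * (1 + q)) ^ 2 := by
    field_simp
    ring
  have h1 : 0 ≤ 2 + q - σ ^ 2 := by nlinarith
  rw [← sub_nonneg, h]
  positivity

/-- Lemma 5.1, subsolution: `v_μ - log(1 + A|z|^{1/μ})` is a
subsolution of Liouville's equation in the cone `V_μ`. -/
theorem liouville_cone_subsolution (μ : ℝ) (hμ0 : 0 < μ) (hμ2 : μ < 2)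
    (A : ℝ) (hA : 0 < A) (w : ℂ → ℝ)
    (hw : ∀ z : ℂ, w z = -Real.log (μ * ‖z‖ * Real.sin (polarAngle z / μ))
      - Real.log (1 + A * ‖z‖ ^ (1 / μ))) :
    ∀ z ∈ cone μ, Real.exp (2 * w z) ≤ lap w z := by
  intro z hz
  obtain ⟨hs, h0, hθ⟩ := neg_mem_slitPlane_and_polarAngle_of_mem_cone hμ2 hz
  have hz0 : z ≠ 0 := by
    rintro rfl
    simp at hs
  have hr : 0 < ‖z‖ := norm_pos_iff.2 hz0
  have hsin : 0 < Real.sin (polarAngle z / μ) := sin_div_pos_of_mem_Ioo hμ0 h0 hθ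
  have hrpow {y : ℂ} (hy : y ≠ 0) : Real.exp (1 / μ * (cutLog y).re) = ‖y‖ ^ (1 / μ) := by
    rw [cutLog_re, Real.rpow_def_of_pos (norm_pos_iff.2 hy), mul_comm]
  have hslit : ∀ᶠ y in 𝓝 z, -y ∈ Complex.slitPlane :=
    continuous_neg.continuousAt.eventually_mem (Complex.isOpen_slitPlane.mem_nhds hs)
  have hsinE : ∀ᶠ y in 𝓝 z, 0 < Real.sin ((cutLog y).im / μ) := by
    have hc : ContinuousAt (fun y => Real.sin ((cutLog y).im / μ)) z :=
      Real.continuous_sin.continuousAt.comp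
        ((Complex.continuous_im.continuousAt.comp (hasDerivAt_cutLog hs).continuousAt).div_const μ)
    exact hc.eventually_const_lt (by simpa only [cutLog_im hs] using hsin)
  have hloc : w =ᶠ[𝓝 z] fun y =>
      (-Real.log μ - (cutLog y).re - Real.log (1 + A * Real.exp (1 / μ * (cutLog y).re)))
        + -Real.log (Real.sin ((cutLog y).im / μ)) := by
    filter_upwards [hslit, hsinE] with y hy hy'
    have hy0 : y ≠ 0 := by
      rintro rfl
      simp at hy
    have hny := norm_pos_iff.2 hy0
    rw [hw, hrpow hy0, ← cutLog_im hy, cutLog_re, Real.log_mul (by positivity) hy'.ne',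
      Real.log_mul hμ0.ne' hny.ne']
    ring
  have hlap := lap_re_add_im_comp
    (hslit.mono fun y hy => hasDerivAt_cutLog hy) (hasDerivAt_inv hz0)
    (Eventually.of_forall fun y =>
      hasDerivAt_neg_sub_log_one_add_exp (s := 1 / μ) hA (-Real.log μ) (cutLog y).re)
    (hsinE.mono fun y hy => hasDerivAt_neg_log_sin_div hy.ne')
    (hasDerivAt_neg_one_sub_logistic hA _)
    (hasDerivAt_neg_cot_div hsinE.self_of_nhds.ne')
  have hq : 0 < A * ‖z‖ ^ (1 / μ) := by positivity
  have hexp : Real.exp (2 * w z) = (1 / μ /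
      (‖z‖ * Real.sin (polarAngle z / μ) * (1 + A * ‖z‖ ^ (1 / μ)))) ^ 2 := by
    rw [two_mul, Real.exp_add, ← sq, hw, Real.exp_sub, Real.exp_neg,
      Real.exp_log (by positivity), Real.exp_log (by positivity)]
    congr 1
    field_simp
  rw [hloc.lap_eq, hlap, hexp, hrpow hz0, cutLog_im hs, Complex.normSq_inv,
    Complex.normSq_eq_norm_sq, ← one_div]
  exact liouville_ineq hr hsin (Real.sin_le_one _) hq
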